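/- arXiv:0910.4437 — 5 statements merged into one kernel-verified Lean document; each statement's English description precedes it below -/
import Mathlib

section
/- Let p be a prime, a ≥ 1 an integer and q = p^a. Let k be a perfect field of characteristic p and W(k) its ring of p-typical Witt vectors; the zeroth-coefficient map π₀ : W(k) → k, x ↦ x.coeff 0, is a ring homomorphism, and the Witt vector Frobenius F_W : W(k) → W(k) is a ring homomorphism (bijective since k is perfect). Let B be a commutative ring and F : B → B a ring endomorphism such that F(b) − b^q ∈ pB for every b ∈ B. Let s̄ : B → k be a ring homomorphism and assume s̄ lifts to W(k), i.e. there is some ring homomorphism t : B → W(k) with π₀ ∘ t = s̄. Then there exists a unique ring homomorphism s : B → W(k) such that π₀ ∘ s = s̄ and s ∘ F = F_W^a ∘ s, where F_W^a denotes the a-th iterate of the Witt vector Frobenius. (This is the Teichmüller lifting of s̄ relative to the Frobenius lift F.) -/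
theorem pow_succ_dvd_pow_sub_pow {R : Type*} [CommRing R] {p q n : ℕ} (hpq : p ∣ q)
    {x y : R} (hxy : (p : R) ∣ x - y) (h : (p : R) ^ n ∣ x - y) :
    (p : R) ^ (n + 1) ∣ x ^ q - y ^ q := by
  obtain ⟨r, rfl⟩ := hpq
  rw [pow_mul, pow_mul]
  refine dvd_trans ?_ (sub_dvd_pow_sub_pow (x ^ p) (y ^ p) r)
  rw [← (Commute.all x y).geom_sum₂_mul p, pow_succ']
  exact mul_dvd_mul (dvd_geom_sum₂_self hxy) h

theorem exists_ringHom_forall_pow_dvd_sub {R B : Type*} [CommRing R] [CommRing B] (p : R)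
    [IsAdicComplete (Ideal.span {p}) R] (u : ℕ → B →+* R)
    (hu : ∀ n b, p ^ n ∣ u (n + 1) b - u n b) :
    ∃ s : B →+* R, ∀ n b, p ^ n ∣ s b - u n b := by
  have key : ∀ n (x y : R), Ideal.Quotient.mk (Ideal.span {p} ^ n) x =
      Ideal.Quotient.mk (Ideal.span {p} ^ n) y ↔ p ^ n ∣ x - y := fun n x y ↦ by
    rw [Ideal.Quotient.eq, Ideal.span_singleton_pow, Ideal.mem_span_singleton]
  have hmn : ∀ {m n : ℕ}, m ≤ n → ∀ b, p ^ m ∣ u n b - u m b := by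
    intro m n hle b
    induction n, hle using Nat.le_induction with
    | base => simp
    | succ n hle ih =>
      rw [← sub_add_sub_cancel _ (u n b)]
      exact dvd_add ((pow_dvd_pow p hle).trans (hu n b)) ih
  refine ⟨IsAdicComplete.liftRingHom (Ideal.span {p})
    (fun n ↦ (Ideal.Quotient.mk (Ideal.span {p} ^ n)).comp (u n)) ?_, fun n b ↦ ?_⟩
  · intro m n hle
    ext b
    exact (key m _ _).2 (hmn hle b)
  · rw [← key, IsAdicComplete.mk_liftRingHom]
    rfl

theorem eq_of_forall_pow_dvd_sub {R : Type*} [CommRing R] (p : R)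
    [IsHausdorff (Ideal.span {p}) R] {x y : R} (h : ∀ n, p ^ n ∣ x - y) : x = y := by
  refine (IsHausdorff.eq_iff_smodEq (I := Ideal.span {p})).2 fun n ↦ ?_
  rw [SModEq.sub_mem, smul_eq_mul, Ideal.mul_top, Ideal.span_singleton_pow,
    Ideal.mem_span_singleton]
  exact h n

/-- Lifts modulo `p` of a homomorphism to a `p`-adically complete ring become unique once they are
required to commute with given Frobenius lifts, provided the one on the target is bijective. -/
theorem existsUnique_ringHom_comm_frobeniusLift {R B : Type*} [CommRing R] [CommRing B]
    {p q : ℕ} (hpq : p ∣ q) [IsAdicComplete (Ideal.span {(p : R)}) R]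
    (φ : R ≃+* R) (hφ : ∀ x, (p : R) ∣ φ x - x ^ q)
    (F : B →+* B) (hF : ∀ b, (p : B) ∣ F b - b ^ q) (t : B →+* R) :
    ∃! s : B →+* R, (∀ b, (p : R) ∣ s b - t b) ∧ ∀ b, s (F b) = φ (s b) := by
  have hsymm : ∀ {n : ℕ} {x : R}, (p : R) ^ n ∣ x → (p : R) ^ n ∣ φ.symm x := fun h ↦ by
    simpa using map_dvd φ.symm h
  have contr : ∀ {n : ℕ} {s s' : B →+* R}, (∀ b, (p : R) ∣ s b - s' b) →
      (∀ b, (p : R) ^ n ∣ s b - s' b) →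
      ∀ b, (p : R) ^ (n + 1) ∣ φ.symm (s (F b)) - φ.symm (s' (F b)) := by
    intro n s s' h₁ h b
    obtain ⟨c, hc⟩ := hF b
    rw [← map_sub]
    apply hsymm
    have hexp : s (F b) - s' (F b) = (s b ^ q - s' b ^ q) + p * (s c - s' c) := by
      rw [sub_eq_iff_eq_add.1 hc]
      simp only [map_add, map_mul, map_natCast, map_pow]
      ring
    rw [hexp]
    refine dvd_add (pow_succ_dvd_pow_sub_pow hpq (h₁ b) (h b)) ?_
    rw [pow_succ']
    exact mul_dvd_mul_left _ (h c)
  have hlift : ∀ (s : B →+* R) b, (p : R) ∣ φ.symm (s (F b)) - s b := by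
    intro s b
    have h₁ : (p : R) ∣ s (F b) - s b ^ q := by simpa using map_dvd s (hF b)
    have h₂ : (p : R) ∣ s (F b) - φ (s b) := by simpa using dvd_sub h₁ (hφ (s b))
    simpa using map_dvd φ.symm h₂
  let T : (B →+* R) → B →+* R := fun s ↦ (φ.symm : R →+* R).comp (s.comp F)
  have hT : ∀ s b, T s b = φ.symm (s (F b)) := fun _ _ ↦ rfl
  let u : ℕ → B →+* R := fun n ↦ T^[n] t
  have hu_zero : u 0 = t := rfl
  have hu_succ : ∀ n, u (n + 1) = T (u n) := fun n ↦ Function.iterate_succ_apply' T n t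
  have hu : ∀ n b, (p : R) ^ (n + 1) ∣ u (n + 1) b - u n b := by
    intro n
    induction n with
    | zero => intro b; simpa [hu_succ, hT, hu_zero] using hlift t b
    | succ n ih =>
      intro b
      have h := contr (fun b ↦ (dvd_pow_self _ n.succ_ne_zero).trans (ih b)) ih b
      rwa [← hT, ← hT, ← hu_succ, ← hu_succ] at h
  obtain ⟨s, hs⟩ := exists_ringHom_forall_pow_dvd_sub (p : R) u
    fun n b ↦ (pow_dvd_pow _ n.le_succ).trans (hu n b)
  have hs_fix : ∀ b, φ.symm (s (F b)) = s b := by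
    refine fun b ↦ eq_of_forall_pow_dvd_sub (p : R) fun n ↦ ?_
    rw [← sub_sub_sub_cancel_right _ _ (u (n + 1) b)]
    refine dvd_sub ?_ ((pow_dvd_pow _ n.le_succ).trans (hs (n + 1) b))
    rw [hu_succ, hT, ← map_sub]
    exact hsymm (hs n (F b))
  have hs_t : ∀ b, (p : R) ∣ s b - t b := fun b ↦ by
    rw [← sub_add_sub_cancel _ (u 1 b)]
    exact dvd_add (by simpa using hs 1 b) (by simpa [hu_zero] using hu 0 b)
  refine ⟨s, ⟨hs_t, fun b ↦ φ.symm_apply_eq.1 (hs_fix b)⟩, ?_⟩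
  rintro s' ⟨ht', hF'⟩
  have hss' : ∀ b, (p : R) ∣ s' b - s b := fun b ↦ by
    simpa using dvd_sub (ht' b) (hs_t b)
  ext b
  refine eq_of_forall_pow_dvd_sub (p : R) fun n ↦ ?_
  induction n generalizing b with
  | zero => simp
  | succ n ih => simpa [hF', hs_fix] using contr hss' ih b


/-- Teichmüller lifting (Katz): given a Frobenius lift `F` (relative to `q = p^a`) on a
commutative ring `B`, a homomorphism `s̄ : B → k` to a perfect field `k` of characteristic `p`
which lifts to the Witt vectors `W(k)` admits a unique lift `s : B → W(k)` commuting with the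
Frobenii, i.e. with `s ∘ F = F_W^a ∘ s`, where `F_W` is the Witt vector Frobenius and
`π₀ : W(k) → k` is the zeroth-coefficient ring homomorphism. -/
theorem teichmuller_lift_exists_unique
    (p a q : ℕ) [Fact p.Prime] (ha : 1 ≤ a) (hq : q = p ^ a)
    (k : Type*) [Field k] [CharP k p] [PerfectRing k p]
    (π₀ : WittVector p k →+* k) (hπ₀ : ∀ x : WittVector p k, π₀ x = x.coeff 0)
    (B : Type*) [CommRing B] (F : B →+* B)
    (hF : ∀ b : B, F b - b ^ q ∈ Ideal.span ({(p : B)} : Set B))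
    (sbar : B →+* k)
    (hlift : ∃ t : B →+* WittVector p k, π₀.comp t = sbar) :
    ∃! s : B →+* WittVector p k,
      π₀.comp s = sbar ∧
      ∀ b : B,
        s (F b) = (⇑(WittVector.frobenius : WittVector p k →+* WittVector p k))^[a] (s b) := by
  obtain ⟨t, ht⟩ := hlift
  have hdvd : ∀ x y : WittVector p k, (p : WittVector p k) ∣ x - y ↔ π₀ x = π₀ y := fun x y ↦ by
    rw [← Ideal.mem_span_singleton, WittVector.mem_span_p_iff_coeff_zero_eq_zero, ← hπ₀, map_sub,
      sub_eq_zero]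
  let φ : WittVector p k ≃+* WittVector p k := WittVector.frobeniusEquiv p k ^ a
  have hφ : ∀ x, φ x = (⇑(WittVector.frobenius : WittVector p k →+* WittVector p k))^[a] x :=
    fun x ↦ congrFun (RingAut.coe_pow (WittVector.frobeniusEquiv p k) a) x
  have hlifts : ∀ s : B →+* WittVector p k,
      π₀.comp s = sbar ↔ ∀ b, (p : WittVector p k) ∣ s b - t b := fun s ↦ by
    simp only [hdvd, ← ht, RingHom.ext_iff, RingHom.comp_apply]
  simp only [hlifts, ← hφ]
  refine existsUnique_ringHom_comm_frobeniusLift (q := q) (hq ▸ dvd_pow_self p (by omega)) φ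
    (fun x ↦ ?_) F (fun b ↦ Ideal.mem_span_singleton.1 (hF b)) t
  rw [hdvd, hφ, map_pow, hπ₀, hπ₀, WittVector.iterate_frobenius_coeff, hq]
end

section
/- Let R be a commutative ring, S an R-algebra that is faithfully flat as an R-module, M an R-module, and Q an S-submodule of S ⊗_R M. Let N₀ be the R-submodule of M consisting of all m ∈ M with 1 ⊗ m ∈ Q. Then the following are equivalent: (i) there exists an R-submodule N of M with N.baseChange S = Q; (ii) N₀.baseChange S = Q. Moreover, if these hold, any submodule N as in (i) equals N₀. (Abstract form of Proposition (5.4.2.3)(a): a submodule of the base change descends if and only if the base change of its contraction recovers it, and the descended submodule is unique, equal to the contraction.) -/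
open TensorProduct

/-- The base change of the contraction of an `S`-submodule `Q` of `S ⊗[R] M` is contained
in `Q`. -/
theorem Submodule.baseChange_comap_mk_le {R S M : Type*} [CommSemiring R] [Semiring S]
    [Algebra R S] [AddCommMonoid M] [Module R M] (Q : Submodule S (S ⊗[R] M)) :
    (Submodule.comap (TensorProduct.mk R S M 1) (Q.restrictScalars R)).baseChange S ≤ Q := by
  rw [Submodule.baseChange_eq_span, Submodule.span_le]
  rintro _ ⟨m, hm, rfl⟩
  exact hm

/-- Abstract form of Proposition (5.4.2.3)(a): over a faithfully flat algebra `S`, an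
`S`-submodule `Q` of `S ⊗[R] M` descends to an `R`-submodule of `M` if and only if the base
change of its contraction `N₀ = {m | 1 ⊗ m ∈ Q}` recovers `Q`; moreover, the descended
submodule is unique, equal to `N₀`. -/
theorem descends_iff_baseChange_comap_eq
    {R S M : Type*} [CommRing R] [CommRing S] [Algebra R S]
    [Module.FaithfullyFlat R S] [AddCommGroup M] [Module R M]
    (Q : Submodule S (S ⊗[R] M)) :
    ((∃ N : Submodule R M, N.baseChange S = Q) ↔
      (Submodule.comap (TensorProduct.mk R S M 1) (Q.restrictScalars R)).baseChange S = Q)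
    ∧ ∀ N : Submodule R M, N.baseChange S = Q →
        N = Submodule.comap (TensorProduct.mk R S M 1) (Q.restrictScalars R) := by
  have unique : ∀ N : Submodule R M, N.baseChange S = Q →
      N = Submodule.comap (TensorProduct.mk R S M 1) (Q.restrictScalars R) := by
    rintro N rfl
    exact le_antisymm (fun m hm => Submodule.tmul_mem_baseChange_of_mem 1 hm)
      ((Submodule.baseChange_le_iff (A := S)).mp (Submodule.baseChange_comap_mk_le _))
  exact ⟨⟨fun ⟨N, hN⟩ => unique N hN ▸ hN, fun h => ⟨_, h⟩⟩, unique⟩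
end

section
/- Let R be a commutative ring and π ∈ R a non-zero-divisor, and assume R is π-adically complete and separated (adically complete with respect to the ideal (π)). Let R_π be the localization of R away from π and ι : R → R_π the canonical map. Call a sequence (a_n) in R_π Cauchy if for every k ∈ ℕ there exists N such that for all m, n ≥ N one has a_m − a_n ∈ ι(π^k R), i.e. a_m − a_n = ι(π^k r) for some r ∈ R. Then every Cauchy sequence in R_π converges: there exists L ∈ R_π such that for every k there is N with L − a_n ∈ ι(π^k R) for all n ≥ N. (This is Lemma (5.4.2.6)(i): with the norm extending the π-adic norm of the complete ring Â, the ring Â_K = Â ⊗ K is complete.) -/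
/-- Lemma (5.4.2.6)(i): if `R` is `π`-adically complete and separated, with `π` a
non-zero-divisor, then every Cauchy sequence (for the `π`-adic filtration transported to
the localization `R[1/π]`) converges in `R[1/π]`. -/
theorem localization_away_cauchy_converges
    {R : Type*} [CommRing R] (π : R)
    (hreg : π ∈ nonZeroDivisors R)
    (hc : IsAdicComplete (Ideal.span ({π} : Set R)) R)
    (a : ℕ → Localization.Away π)
    (hcauchy : ∀ k : ℕ, ∃ N : ℕ, ∀ m n : ℕ, N ≤ m → N ≤ n →
      ∃ r : R, a m - a n = algebraMap R (Localization.Away π) (π ^ k * r)) :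
    ∃ L : Localization.Away π, ∀ k : ℕ, ∃ N : ℕ, ∀ n : ℕ, N ≤ n →
      ∃ r : R, L - a n = algebraMap R (Localization.Away π) (π ^ k * r) := by
  have hinj : Function.Injective (algebraMap R (Localization.Away π)) :=
    IsLocalization.injective _ (Submonoid.powers_le.mpr hreg)
  choose N hN using hcauchy
  obtain ⟨M, hM⟩ : ∃ M : ℕ → ℕ, ∀ i k, i ≤ k → N i ≤ M k :=
    ⟨fun k ↦ (Finset.range (k + 1)).sup N, fun i k hik ↦
      Finset.le_sup (Finset.mem_range.mpr (Nat.lt_succ_of_le hik))⟩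
  have hb (k : ℕ) : ∃ r : R, a (M k) - a (M 0) = algebraMap R (Localization.Away π) r := by
    simpa using hN 0 (M k) (M 0) (hM 0 k k.zero_le) (hM 0 0 le_rfl)
  choose b hb using hb
  have smodEq_iff (x y : R) (k : ℕ) :
      x ≡ y [SMOD (Ideal.span ({π} : Set R) ^ k • ⊤ : Submodule R R)] ↔ π ^ k ∣ x - y := by
    rw [SModEq.sub_mem, smul_eq_mul, Ideal.mul_top, Ideal.span_singleton_pow,
      Ideal.mem_span_singleton]
  obtain ⟨l, hl⟩ := hc.toIsPrecomplete.prec' b fun {m n} hmn ↦ by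
    obtain ⟨r, hr⟩ := hN m (M m) (M n) (hM m m le_rfl) (hM m n hmn)
    refine (smodEq_iff _ _ _).mpr ⟨r, hinj ?_⟩
    rw [← hr, map_sub, ← hb, ← hb, sub_sub_sub_cancel_right]
  refine ⟨a (M 0) + algebraMap R (Localization.Away π) l, fun k ↦ ⟨N k, fun n hn ↦ ?_⟩⟩
  obtain ⟨r, hr⟩ := hN k (M k) n (hM k k le_rfl) hn
  obtain ⟨s, hs⟩ := (smodEq_iff _ _ _).mp (hl k)
  refine ⟨r - s, ?_⟩
  rw [mul_sub, map_sub, ← hr, ← hs, map_sub, ← hb]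
  ring
end

section
/- Let L be a field, g : L → L a ring automorphism, and r ≥ 1 an integer such that the r-th iterate of g is the identity of L. Let C be an m × m matrix with entries in L and set D = C^{(r−1)} · C^{(r−2)} · ⋯ · C^{(1)} · C, where C^{(j)} denotes the matrix obtained by applying the j-th iterate of g to every entry of C. Then the characteristic polynomial of D is fixed by g coefficientwise: applying g to each coefficient of charpoly(D) returns charpoly(D). (Computational core of Lemma (2.5)(i): the twisted product C(t^{q^{deg x −1}}) ⋯ C(t^q) C(t) giving the Frobenius iterate at a Teichmüller point has characteristic polynomial with coefficients invariant under σ, hence lying in the base field K.) -/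
/-- Computational core of Lemma (2.5)(i): if `g` is a ring automorphism of a field `L`
with `g^r = id`, and `D = C^{(r-1)} ⋯ C^{(1)} C` is the twisted product of an `m × m`
matrix `C` (where `C^{(j)}` is obtained by applying `g^j` entrywise), then the
characteristic polynomial of `D` is fixed coefficientwise by `g`. -/
theorem charpoly_twisted_product_fixed
    {L : Type*} [Field L] (g : L ≃+* L) (r : ℕ) (hr : 1 ≤ r)
    (hgr : ∀ x : L, (⇑g)^[r] x = x)
    (m : ℕ) (C : Matrix (Fin m) (Fin m) L) :
    (Matrix.charpoly (((List.range r).reverse.map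
        (fun j => C.map ((⇑g)^[j]))).prod)).map (g : L →+* L)
      = Matrix.charpoly (((List.range r).reverse.map
        (fun j => C.map ((⇑g)^[j]))).prod) := by
  obtain ⟨k, rfl⟩ : ∃ k, r = k + 1 := ⟨r - 1, by omega⟩
  have h_map : ∀ j : ℕ, (g : L →+* L).mapMatrix (C.map ((⇑g)^[j])) = C.map ((⇑g)^[j + 1]) := by
    intro j
    ext a b
    exact (Function.iterate_succ_apply' (⇑g) j (C a b)).symm
  have h_period : C.map ((⇑g)^[k + 1]) = C.map ((⇑g)^[0]) := by
    ext a b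
    simpa using hgr (C a b)
  rw [← Matrix.charpoly_map, ← RingHom.mapMatrix_apply, map_list_prod, List.map_map]
  have h_comp : ((g : L →+* L).mapMatrix ∘ fun j => C.map ((⇑g)^[j])) =
      fun j => C.map ((⇑g)^[j + 1]) := funext h_map
  rw [h_comp]
  conv_lhs => rw [List.range_succ, List.reverse_append, List.map_append, List.prod_append]
  conv_rhs => rw [List.range_succ_eq_map, List.reverse_cons, List.map_append, List.prod_append,
    ← List.map_reverse, List.map_map, Matrix.charpoly_mul_comm]
  simp only [List.reverse_singleton, List.map_singleton, List.prod_singleton, h_period]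
  rfl
end

section
/- Let L be a field, Γ a linearly ordered commutative group with zero, v : L → Γ a valuation, and g : L → L a ring automorphism preserving the valuation, i.e. v(g(x)) = v(x) for all x ∈ L. Let r be a natural number, a : Fin r → L a family of elements, and P = ∏_{j} (1 − a_j·X) ∈ L[X]. Assume that P is fixed by g coefficientwise, i.e. mapping the coefficients of P by g returns P. Then for every value γ ∈ Γ, the slope-γ partial product P_γ = ∏_{j : v(a_j) = γ} (1 − a_j·X) is also fixed by g coefficientwise. (This is the claim of §5.1 justifying definition (5.1.1): since σ_{K'(x)} is an isometric extension permuting the inverse roots a_{j,x} of det(𝓜_x, t) and preserving ord_{π_x}, each slope-α factor det_α(𝓜_x, t) has coefficients invariant under σ, hence in K.) -/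
open Polynomial

theorem reflect_card_prod_one_sub_C_mul_X {R : Type*} [CommRing R] (s : Multiset R) :
    reflect s.card (s.map fun x => 1 - C x * X).prod = (s.map fun x => X - C x).prod := by
  have natDegree_le (x : R) : (1 - C x * X).natDegree ≤ 1 := by compute_degree
  have natDegree_prod_le (s : Multiset R) :
      (s.map fun x => 1 - C x * X).prod.natDegree ≤ s.card := by
    induction s using Multiset.induction_on with
    | empty => simp
    | cons x s ih =>
      rw [Multiset.map_cons, Multiset.prod_cons, Multiset.card_cons, add_comm]
      exact natDegree_mul_le_of_le (natDegree_le x) ih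
  induction s using Multiset.induction_on with
  | empty => simp
  | cons x s ih =>
    have reflect_factor : reflect 1 (1 - C x * X) = X - C x := by
      rw [reflect_sub, reflect_C_mul, reflect_one_X, reflect_one, pow_one, mul_one]
    rw [Multiset.map_cons, Multiset.prod_cons, Multiset.card_cons, add_comm,
      reflect_mul _ _ (natDegree_le x) (natDegree_prod_le s), ih, reflect_factor,
      Multiset.map_cons, Multiset.prod_cons]

theorem multiset_eq_of_prod_one_sub_C_mul_X_eq {R : Type*} [CommRing R] [IsDomain R]
    {s t : Multiset R} (hcard : s.card = t.card)
    (h : (s.map fun x => 1 - C x * X).prod = (t.map fun x => 1 - C x * X).prod) : s = t := by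
  rw [← roots_multiset_prod_X_sub_C s, ← roots_multiset_prod_X_sub_C t,
    ← reflect_card_prod_one_sub_C_mul_X, ← reflect_card_prod_one_sub_C_mul_X, h, hcard]

theorem map_prod_one_sub_C_mul_X {R S : Type*} [CommRing R] [CommRing S] (f : R →+* S)
    (s : Multiset R) :
    (s.map fun x => 1 - C x * X).prod.map f = ((s.map f).map fun x => 1 - C x * X).prod := by
  simp [Polynomial.map_multiset_prod, Multiset.map_map]

/-- §5.1: if an isometric ring automorphism `g` (for a valuation `v`) fixes the
polynomial `P = ∏ⱼ (1 - aⱼ X)` coefficientwise, then for every value `γ` it also fixes the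
slope-`γ` partial product `∏_{v(aⱼ) = γ} (1 - aⱼ X)` coefficientwise. -/
theorem slope_factor_fixed_of_fixed
    {L : Type*} [Field L] {Γ : Type*} [LinearOrderedCommGroupWithZero Γ] [DecidableEq Γ]
    (v : Valuation L Γ) (g : L ≃+* L) (hg : ∀ x : L, v (g x) = v x)
    (r : ℕ) (a : Fin r → L)
    (hP : (∏ j, (1 - Polynomial.C (a j) * Polynomial.X)).map (g : L →+* L)
        = ∏ j, (1 - Polynomial.C (a j) * Polynomial.X))
    (γ : Γ) :
    (∏ j ∈ Finset.univ.filter (fun j => v (a j) = γ),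
        (1 - Polynomial.C (a j) * Polynomial.X)).map (g : L →+* L)
      = ∏ j ∈ Finset.univ.filter (fun j => v (a j) = γ),
        (1 - Polynomial.C (a j) * Polynomial.X) := by
  have prod_eq (t : Finset (Fin r)) : ∏ j ∈ t, (1 - C (a j) * X) =
      ((t.val.map a).map fun x => 1 - C x * X).prod := by
    rw [Multiset.map_map]
    rfl
  have filter_eq : (Finset.univ.filter fun j => v (a j) = γ).val.map a =
      (Finset.univ.val.map a).filter fun x => v x = γ := by
    rw [Multiset.filter_map]
    rfl
  rw [prod_eq, map_prod_one_sub_C_mul_X] at hP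
  have map_eq := multiset_eq_of_prod_one_sub_C_mul_X_eq (by simp) hP
  rw [prod_eq, map_prod_one_sub_C_mul_X, filter_eq]
  congr 2
  conv_rhs => rw [← map_eq, Multiset.filter_map]
  simp [Function.comp_def, hg]
end
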